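/- For every k ≥ 3 and every n ≥ 1, the superalgebra N_k^{gr} (N_k with the elementary grading induced by (0,1,…,1)) satisfies c_n^{gr,z}(N_k^{gr}) = 1 + Σ_{i=1}^{k−2} i·C(n,i) and δ_n^{gr}(N_k^{gr}) = (k−1)·C(n,k−1). -/

import Mathlib

noncomputable section

/-- The free superalgebra `F⟨Y,Z⟩`: the free unital associative `F`-algebra on the
even variables `Sum.inl i` (representing `y_{i+1}`) and the odd variables
`Sum.inr j` (representing `z_{j+1}`). -/
abbrev FA (F : Type) [Field F] : Type := FreeAlgebra F (ℕ ⊕ ℕ)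

variable (F : Type) [Field F]

/-- the even variable `y_{i+1}` -/
def yv (i : ℕ) : FA F := FreeAlgebra.ι F (Sum.inl i)

/-- the odd variable `z_{j+1}` -/
def zv (j : ℕ) : FA F := FreeAlgebra.ι F (Sum.inr j)

/-- the constant term of an element of `F⟨Y,Z⟩` -/
def constTerm : FA F →ₐ[F] F := FreeAlgebra.lift F (fun _ => (0 : F))

/-- the commutator `[a,b] = ab - ba` -/
def brk {R : Type} [Ring R] (a b : R) : R := a * b - b * a

/-- the left-normed commutator `[a, l₁, l₂, …]` -/
def lnc {R : Type} [Ring R] (a : R) (l : List R) : R := l.foldl brk a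

section SuperAlg

variable (B : Type) [Ring B] [Algebra F B]

/-- the center of the (possibly non-unital) subalgebra of `B` whose underlying
subspace is `S`, as a submodule of `B` -/
def centerIn (S : Submodule F B) : Submodule F B where
  carrier := {x | x ∈ S ∧ ∀ y ∈ S, x * y = y * x}
  add_mem' := by
    rintro a b ⟨ha, ha'⟩ ⟨hb, hb'⟩
    exact ⟨S.add_mem ha hb, fun y hy => by rw [add_mul, mul_add, ha' y hy, hb' y hy]⟩
  zero_mem' := ⟨S.zero_mem, fun y _ => by rw [zero_mul, mul_zero]⟩
  smul_mem' := by
    rintro c a ⟨ha, ha'⟩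
    exact ⟨S.smul_mem c ha, fun y hy => by rw [smul_mul_assoc, mul_smul_comm, ha' y hy]⟩

variable (A0 A1 : Submodule F B)

/-- a graded substitution: an algebra evaluation sending each `yᵢ` into the even
component `A0` and each `zⱼ` into the odd component `A1` -/
def IsGSubst (φ : FA F →ₐ[F] B) : Prop :=
  (∀ i, φ (yv F i) ∈ A0) ∧ (∀ j, φ (zv F j) ∈ A1)

/-- the graded identities of the superalgebra with even part `A0` and odd part `A1` -/
def IdGr : Submodule F (FA F) where
  carrier := {f | ∀ φ : FA F →ₐ[F] B, IsGSubst F B A0 A1 φ → φ f = 0}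
  add_mem' := by
    intro f g hf hg φ hφ
    rw [map_add, hf φ hφ, hg φ hφ, add_zero]
  zero_mem' := fun φ _ => map_zero φ
  smul_mem' := by
    intro c f hf φ hφ
    rw [map_smul, hf φ hφ, smul_zero]

/-- the central graded polynomials of the superalgebra with even part `A0` and
odd part `A1`: the polynomials with zero constant term all of whose graded
evaluations lie in the center of the superalgebra -/
def CGr : Submodule F (FA F) where
  carrier := {f | constTerm F f = 0 ∧
    ∀ φ : FA F →ₐ[F] B, IsGSubst F B A0 A1 φ → φ f ∈ centerIn F B (A0 ⊔ A1)}
  add_mem' := by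
    rintro f g ⟨hf0, hf⟩ ⟨hg0, hg⟩
    refine ⟨by rw [map_add, hf0, hg0, add_zero], fun φ hφ => ?_⟩
    rw [map_add]
    exact (centerIn F B (A0 ⊔ A1)).add_mem (hf φ hφ) (hg φ hφ)
  zero_mem' :=
    ⟨map_zero _, fun φ _ => by
      rw [map_zero]; exact (centerIn F B (A0 ⊔ A1)).zero_mem⟩
  smul_mem' := by
    rintro c f ⟨hf0, hf⟩
    refine ⟨by rw [map_smul, hf0, smul_zero], fun φ hφ => ?_⟩
    rw [map_smul]
    exact (centerIn F B (A0 ⊔ A1)).smul_mem c (hf φ hφ)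

end SuperAlg

/-- the space `P_n^{gr}` of multilinear graded polynomials of degree `n`,
spanned by `w_{σ(1)} ⋯ w_{σ(n)}` with `wᵢ ∈ {yᵢ, zᵢ}` -/
def PnGr (n : ℕ) : Submodule F (FA F) :=
  Submodule.span F
    {m : FA F | ∃ (σ : Equiv.Perm (Fin n)) (w : Fin n → Bool),
      m = (List.ofFn fun i : Fin n =>
        if w (σ i) then zv F (σ i).val else yv F (σ i).val).prod}

/-- `dim P / (P ∩ C)` -/
def scodim (P C : Submodule F (FA F)) : ℕ :=
  Module.finrank F (↥P ⧸ Submodule.comap P.subtype C)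

/-- `dim (P ⊓ C) / (P ⊓ I)` -/
def deltaDim (P C I : Submodule F (FA F)) : ℕ :=
  Module.finrank F (↥(P ⊓ C) ⧸ Submodule.comap (P ⊓ C).subtype (P ⊓ I))

/-- the parity automorphism of `F⟨Y,Z⟩`, fixing the `yᵢ` and negating the `zⱼ` -/
def omegaFA : FA F →ₐ[F] FA F :=
  FreeAlgebra.lift F (fun v => match v with
    | Sum.inl i => FreeAlgebra.ι F (Sum.inl i)
    | Sum.inr j => - FreeAlgebra.ι F (Sum.inr j))

/-- an even (degree-0) element of the free superalgebra -/
def IsEvenFA (f : FA F) : Prop := omegaFA F f = f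

/-- an odd (degree-1) element of the free superalgebra -/
def IsOddFA (f : FA F) : Prop := omegaFA F f = - f

/-- a graded endomorphism of the free superalgebra: sends `Y`-variables to even
elements and `Z`-variables to odd elements -/
def IsT2Endo (φ : FA F →ₐ[F] FA F) : Prop :=
  (∀ i, IsEvenFA F (φ (yv F i))) ∧ (∀ j, IsOddFA F (φ (zv F j)))

/-- a T₂-space: a subspace invariant under all graded endomorphisms -/
def IsT2Space (V : Submodule F (FA F)) : Prop :=
  ∀ φ : FA F →ₐ[F] FA F, IsT2Endo F φ → ∀ f ∈ V, φ f ∈ V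

/-- the smallest T₂-space of `F⟨Y,Z⟩` containing `S` -/
def T2SpaceGen (S : Set (FA F)) : Submodule F (FA F) :=
  sInf {V : Submodule F (FA F) | S ⊆ ↑V ∧ IsT2Space F V}

/-- a T₂-ideal: a two-sided ideal invariant under all graded endomorphisms -/
def IsT2Ideal (I : Submodule F (FA F)) : Prop :=
  (∀ f ∈ I, ∀ g : FA F, g * f ∈ I ∧ f * g ∈ I) ∧ IsT2Space F I

/-- the smallest T₂-ideal of `F⟨Y,Z⟩` containing `S` -/
def T2IdealGen (S : Set (FA F)) : Submodule F (FA F) :=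
  sInf {I : Submodule F (FA F) | S ⊆ ↑I ∧ IsT2Ideal F I}

/-- the products `z_{i₁}⋯z_{i_k} · w₁⋯w_s` where every `wⱼ` is a left-normed
commutator of weight ≥ 2 in the variables and `k + s ≥ 1`; proper
ℤ₂-polynomials are the linear combinations of these -/
def properProds : Set (FA F) :=
  {p | ∃ (zs : List ℕ) (ws : List (FA F)),
      (∀ w ∈ ws, ∃ (v : ℕ ⊕ ℕ) (l : List (ℕ ⊕ ℕ)), l ≠ [] ∧
        w = lnc (FreeAlgebra.ι F v) (l.map (FreeAlgebra.ι F))) ∧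
      1 ≤ zs.length + ws.length ∧
      p = (zs.map (zv F)).prod * ws.prod}

/-- the Jacobson radical `J(A)`, as an `F`-submodule of `A` -/
def Jrad (A : Type) [Ring A] [Algebra F A] : Submodule F A :=
  Submodule.restrictScalars F ((⊥ : Ideal A).jacobson)

/-- `J' = J(A) ∩ Z(A)` -/
def Jprime (A : Type) [Ring A] [Algebra F A] : Submodule F A :=
  Jrad F A ⊓ Subalgebra.toSubmodule (Subalgebra.center F A)

/-- the matrix unit `e_{i+1,j+1}` (0-indexed position `(i,j)`) -/
def eMat (k i j : ℕ) : Matrix (Fin k) (Fin k) F :=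
  Matrix.of fun a b => if (a : ℕ) = i ∧ (b : ℕ) = j then 1 else 0

/-- the matrix `E = e_{12} + e_{23} + ⋯ + e_{k-1,k}` -/
def EMat (k : ℕ) : Matrix (Fin k) (Fin k) F :=
  Matrix.of fun a b => if (a : ℕ) + 1 = (b : ℕ) then 1 else 0

/-- `N_k = span_F{I_k, E, …, E^{k-2}, e_{12}, …, e_{1k}}` -/
def NkSub (k : ℕ) : Submodule F (Matrix (Fin k) (Fin k) F) :=
  Submodule.span F
    ({1} ∪ {x | ∃ m, 1 ≤ m ∧ m ≤ k - 2 ∧ x = EMat F k ^ m}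
      ∪ {x | ∃ j, 1 ≤ j ∧ j ≤ k - 1 ∧ x = eMat F k 0 j})

/-- `A_k = span_F{e_{11}, E, …, E^{k-2}, e_{12}, …, e_{1k}}` -/
def AkSub (k : ℕ) : Submodule F (Matrix (Fin k) (Fin k) F) :=
  Submodule.span F
    ({eMat F k 0 0} ∪ {x | ∃ m, 1 ≤ m ∧ m ≤ k - 2 ∧ x = EMat F k ^ m}
      ∪ {x | ∃ j, 1 ≤ j ∧ j ≤ k - 1 ∧ x = eMat F k 0 j})

/-- `B_k = span_F{e_{kk}, E, …, E^{k-2}, e_{1k}, …, e_{k-1,k}}` -/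
def BkSub (k : ℕ) : Submodule F (Matrix (Fin k) (Fin k) F) :=
  Submodule.span F
    ({eMat F k (k - 1) (k - 1)} ∪ {x | ∃ m, 1 ≤ m ∧ m ≤ k - 2 ∧ x = EMat F k ^ m}
      ∪ {x | ∃ i, i ≤ k - 2 ∧ x = eMat F k i (k - 1)})

/-- the even part of `Matrix (Fin k) (Fin k) F` under the elementary ℤ₂-grading
induced by `(0,1,…,1)`: matrices vanishing at the odd positions `(i,j)`
(those where exactly one of `i`, `j` equals the first index) -/
def matEvenPart (k : ℕ) : Submodule F (Matrix (Fin k) (Fin k) F) where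
  carrier := {x | ∀ i j : Fin k, (((i : ℕ) = 0) ↔ ¬((j : ℕ) = 0)) → x i j = 0}
  add_mem' := by
    intro a b ha hb i j h
    simp [Matrix.add_apply, ha i j h, hb i j h]
  zero_mem' := by intro i j _; simp
  smul_mem' := by
    intro c a ha i j h
    simp [Matrix.smul_apply, ha i j h]

/-- the odd part of `Matrix (Fin k) (Fin k) F` under the elementary ℤ₂-grading
induced by `(0,1,…,1)`: matrices vanishing at the even positions -/
def matOddPart (k : ℕ) : Submodule F (Matrix (Fin k) (Fin k) F) where
  carrier := {x | ∀ i j : Fin k, (((i : ℕ) = 0) ↔ ((j : ℕ) = 0)) → x i j = 0}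
  add_mem' := by
    intro a b ha hb i j h
    simp [Matrix.add_apply, ha i j h, hb i j h]
  zero_mem' := by intro i j _; simp
  smul_mem' := by
    intro c a ha i j h
    simp [Matrix.smul_apply, ha i j h]

section Grassmann

variable (M : Type) [AddCommGroup M] [Module F M]

/-- the main involution of the Grassmann (exterior) algebra, negating the
generators -/
def grassInvol : ExteriorAlgebra F M →ₐ[F] ExteriorAlgebra F M :=
  ExteriorAlgebra.lift F ⟨-(ExteriorAlgebra.ι F (M := M)), fun m => by
    simp [ExteriorAlgebra.ι_sq_zero]⟩

/-- the even (degree-0) part of the canonical ℤ₂-grading of the Grassmann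
algebra: the span of `1` and the products of the generators of even length -/
def grEven : Submodule F (ExteriorAlgebra F M) :=
  LinearMap.ker ((grassInvol F M).toLinearMap - LinearMap.id)

/-- the odd (degree-1) part of the canonical ℤ₂-grading of the Grassmann
algebra: the span of the products of the generators of odd length -/
def grOdd : Submodule F (ExteriorAlgebra F M) :=
  LinearMap.ker ((grassInvol F M).toLinearMap + LinearMap.id)

end Grassmann

end


/-! ### Part 1: generic evaluation -/
section Part1
variable {F : Type} [Field F] {R : Type} [CommRing R] [Algebra F R]

noncomputable def PsiM (F : Type) [Field F] {R : Type} [CommRing R] [Algebra F R]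
    (a d b : ℕ → R) : FA F →ₐ[F] Matrix (Fin 2) (Fin 2) R :=
  FreeAlgebra.lift F (Sum.elim (fun i => !![a i, 0; 0, d i]) (fun j => !![0, b j; 0, 0]))

theorem PsiM_y (a d b : ℕ → R) (i : ℕ) : PsiM F a d b (yv F i) = !![a i, 0; 0, d i] := by
  simp [PsiM, yv]

theorem PsiM_z (a d b : ℕ → R) (i : ℕ) : PsiM F a d b (zv F i) = !![0, b i; 0, 0] := by
  simp [PsiM, zv]

noncomputable def lett (F : Type) [Field F] (w : ℕ → Bool) (i : ℕ) : FA F :=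
  if w i then zv F i else yv F i

noncomputable def mono (F : Type) [Field F] (w : ℕ → Bool) (L : List ℕ) : FA F :=
  (L.map (lett F w)).prod

theorem mono_append (w : ℕ → Bool) (L M : List ℕ) :
    mono F w (L ++ M) = mono F w L * mono F w M := by simp [mono]

theorem mono_cons (w : ℕ → Bool) (i : ℕ) (M : List ℕ) :
    mono F w (i :: M) = lett F w i * mono F w M := by simp [mono]

theorem psi_even (a d b : ℕ → R) (w : ℕ → Bool) (L : List ℕ) (h : ∀ i ∈ L, w i = false) :
    PsiM F a d b (mono F w L) = !![(L.map a).prod, 0; 0, (L.map d).prod] := by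
  induction L with
  | nil => simp [mono, Matrix.one_fin_two]
  | cons i L ih =>
    rw [mono_cons, map_mul, ih (fun j hj => h j (by simp [hj]))]
    simp [lett, h i (by simp), PsiM_y]

theorem psi_one (a d b : ℕ → R) (w : ℕ → Bool) (u v : List ℕ) (j : ℕ)
    (hu : ∀ i ∈ u, w i = false) (hv : ∀ i ∈ v, w i = false) (hj : w j = true) :
    PsiM F a d b (mono F w (u ++ j :: v)) =
      !![0, (u.map a).prod * (b j * (v.map d).prod); 0, 0] := by
  rw [mono_append, mono_cons, map_mul, map_mul, psi_even a d b w u hu, psi_even a d b w v hv]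
  simp [lett, hj, PsiM_z]
  ext i; fin_cases i <;> rfl

theorem psi_two (a d b : ℕ → R) (w : ℕ → Bool) (u v x : List ℕ) (j j' : ℕ)
    (hu : ∀ i ∈ u, w i = false) (hv : ∀ i ∈ v, w i = false) (hj : w j = true) (hj' : w j' = true) :
    PsiM F a d b (mono F w (u ++ j :: (v ++ j' :: x))) = 0 := by
  have : u ++ j :: (v ++ j' :: x) = (u ++ j :: v) ++ j' :: x := by simp
  rw [this, mono_append, mono_cons, map_mul, map_mul, psi_one a d b w u v j hu hv hj,
    ← mul_assoc]
  have : lett F w j' = zv F j' := by simp [lett, hj']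
  rw [this, PsiM_z]
  have : !![0, (u.map a).prod * (b j * (v.map d).prod); 0, 0] * !![0, b j'; 0, 0]
      = (0 : Matrix (Fin 2) (Fin 2) R) := by
    ext i j; fin_cases i <;> fin_cases j <;> simp
  rw [this, zero_mul]

theorem split_odd (w : ℕ → Bool) (L : List ℕ) :
    (∀ i ∈ L, w i = false) ∨ ∃ u j v, L = u ++ j :: v ∧ (∀ i ∈ u, w i = false) ∧ w j = true := by
  induction L with
  | nil => simp
  | cons i L ih =>
    cases hi : w i with
    | true => exact Or.inr ⟨[], i, L, by simp, by simp, hi⟩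
    | false =>
      rcases ih with h | ⟨u, j, v, h1, h2, h3⟩
      · left; simpa [hi] using h
      · refine Or.inr ⟨i :: u, j, v, by simp [h1], by simpa [hi] using h2, h3⟩

noncomputable def TT (F : Type) [Field F] (j : ℕ) (V : Finset ℕ) : FA F →ₗ[F] F :=
  (Matrix.entryLinearMap F F (0 : Fin 2) (1 : Fin 2)).comp
    (PsiM F (R := F) (fun i => if i ∈ V then 0 else 1) (fun _ => 1)
      (fun i => if i = j then 1 else 0)).toLinearMap

noncomputable def T0 (F : Type) [Field F] : FA F →ₗ[F] F :=
  (Matrix.entryLinearMap F F (1 : Fin 2) (1 : Fin 2)).comp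
    (PsiM F (R := F) (fun _ => 1) (fun _ => 1) (fun _ => 0)).toLinearMap

theorem TT_apply (j : ℕ) (V : Finset ℕ) (f : FA F) : TT F j V f =
  (PsiM F (R := F) (fun i => if i ∈ V then 0 else 1) (fun _ => 1)
      (fun i => if i = j then 1 else 0)) f 0 1 := rfl

theorem T0_apply (f : FA F) : T0 F f =
  (PsiM F (R := F) (fun _ => 1) (fun _ => 1) (fun _ => 0)) f 1 1 := rfl

theorem TT_one (w : ℕ → Bool) (u v : List ℕ) (j : ℕ)
    (hu : ∀ i ∈ u, w i = false) (hv : ∀ i ∈ v, w i = false) (hj : w j = true)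
    (j' : ℕ) (V : Finset ℕ) :
    TT F j' V (mono F w (u ++ j :: v)) = if j = j' ∧ ∀ i ∈ u, i ∉ V then 1 else 0 := by
  rw [TT_apply, psi_one _ _ _ w u v j hu hv hj]
  have : (u.map (fun i => if i ∈ V then (0 : F) else 1)).prod
      = if ∀ i ∈ u, i ∉ V then 1 else 0 := by
    clear hu
    induction u with
    | nil => simp
    | cons i u ih =>
      by_cases hi : i ∈ V <;> simp [hi, ih]
  by_cases hjj : j = j' <;> simp [this, hjj]

theorem T0_one (w : ℕ → Bool) (u v : List ℕ) (j : ℕ)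
    (hu : ∀ i ∈ u, w i = false) (hv : ∀ i ∈ v, w i = false) (hj : w j = true) :
    T0 F (mono F w (u ++ j :: v)) = 0 := by
  rw [T0_apply, psi_one _ _ _ w u v j hu hv hj]; simp

theorem TT_even (w : ℕ → Bool) (u : List ℕ) (hu : ∀ i ∈ u, w i = false)
    (j' : ℕ) (V : Finset ℕ) : TT F j' V (mono F w u) = 0 := by
  rw [TT_apply, psi_even _ _ _ w u hu]; simp

theorem T0_even (w : ℕ → Bool) (u : List ℕ) (hu : ∀ i ∈ u, w i = false) :
    T0 F (mono F w u) = 1 := by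
  rw [T0_apply, psi_even _ _ _ w u hu]; simp

theorem range_prod {u : List ℕ} {n : ℕ} (hL : u.Perm (List.range n)) (d : ℕ → R) :
    (u.map d).prod = ∏ i ∈ Finset.range n, d i := by
  rw [(hL.map d).prod_eq]
  rw [← List.prod_toFinset d List.nodup_range, List.toFinset_range]

theorem PnGr_eq (n : ℕ) : PnGr F n = Submodule.span F
    {m : FA F | ∃ (L : List ℕ) (w : ℕ → Bool), L.Perm (List.range n) ∧ m = mono F w L} := by
  unfold PnGr
  congr 1
  ext m
  constructor
  · rintro ⟨σ, w, rfl⟩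
    refine ⟨List.ofFn (fun i => (σ i).val), fun i => if h : i < n then w ⟨i, h⟩ else false, ?_, ?_⟩
    · rw [List.perm_ext_iff_of_nodup _ List.nodup_range]
      · intro a
        simp only [List.mem_ofFn, List.mem_range]
        constructor
        · rintro ⟨i, rfl⟩; exact (σ i).2
        · intro h; exact ⟨σ.symm ⟨a, h⟩, by simp⟩
      · rw [List.nodup_ofFn]
        exact Fin.val_injective.comp σ.injective
    · unfold mono
      rw [List.map_ofFn]
      congr 2
      ext i
      simp [lett]
  · rintro ⟨L, w, hL, rfl⟩
    have hlen : L.length = n := by simpa using hL.length_eq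
    have hnd : L.Nodup := hL.nodup_iff.mpr List.nodup_range
    subst hlen
    have hlt : ∀ i : Fin L.length, L.get i < L.length := fun i => by
      have := hL.mem_iff.mp (List.get_mem L i); simpa using this
    let g : Fin L.length → Fin L.length := fun i => ⟨L.get i, hlt i⟩
    have hg : Function.Injective g := fun i j h => by
      have : L.get i = L.get j := congrArg Fin.val h
      exact (List.nodup_iff_injective_get.mp hnd) this
    refine ⟨Equiv.ofBijective g (Finite.injective_iff_bijective.mp hg), fun i => w i, ?_⟩
    unfold mono
    congr 1
    conv_lhs => rw [← List.ofFn_get L]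
    rw [List.map_ofFn]
    congr 1

theorem main_formula (n : ℕ) (a d b : ℕ → R) (f : FA F) (hf : f ∈ PnGr F n) :
    PsiM F a d b f 1 1 = T0 F f • ∏ i ∈ Finset.range n, d i ∧
    PsiM F a d b f 0 1 = ∑ j ∈ Finset.range n, ∑ V ∈ ((Finset.range n).erase j).powerset,
      TT F j V f • (b j * ((∏ i ∈ V, (d i - a i)) *
        ∏ i ∈ ((Finset.range n).erase j) \ V, a i)) := by
  rw [PnGr_eq] at hf
  induction hf using Submodule.span_induction with
  | zero => simp
  | add x y hx hy h1 h2 =>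
    simp only [map_add, Matrix.add_apply, add_smul, Finset.sum_add_distrib, h1.1, h1.2, h2.1, h2.2,
      and_self]
  | smul c x hx h1 =>
    simp only [map_smul, Matrix.smul_apply, smul_assoc, ← Finset.smul_sum, h1.1, h1.2, and_self]
  | mem x hx =>
    obtain ⟨L, w, hL, rfl⟩ := hx
    rcases split_odd w L with h | ⟨u, j, v, rfl, hu, hj⟩
    · rw [psi_even _ _ _ w L h, T0_even w L h]
      simp [TT_even w L h, range_prod hL]
    · rcases split_odd w v with hv | ⟨v, j', x, rfl, hv, hj'⟩
      · have hnd : (u ++ j :: v).Nodup := hL.nodup_iff.mpr List.nodup_range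
        rw [psi_one _ _ _ w u v j hu hv hj, T0_one w u v j hu hv hj]
        simp only [TT_one w u v j hu hv hj]
        have hmem : ∀ i, i ∈ Finset.range n ↔ (i ∈ u ∨ i = j ∨ i ∈ v) := by
          intro i
          have := hL.mem_iff (a := i)
          simp at this; simp [← this]
        refine ⟨by simp, ?_⟩
        rw [List.nodup_append] at hnd
        obtain ⟨hun, hjv, hdis⟩ := hnd
        rw [List.nodup_cons] at hjv
        rw [Finset.sum_eq_single j]
        · have hsub : v.toFinset.powerset ⊆ ((Finset.range n).erase j).powerset := by
            rw [Finset.powerset_mono]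
            intro i hi
            rw [List.mem_toFinset] at hi
            rw [Finset.mem_erase, hmem]
            exact ⟨fun h => hjv.1 (h ▸ hi), by simp [hi]⟩
          rw [← Finset.sum_subset hsub]
          · have hd : (v.map d).prod = ∏ i ∈ v.toFinset, ((d i - a i) + a i) := by
              rw [List.prod_toFinset _ hjv.2]; simp
            have ha : (u.map a).prod = ∏ i ∈ u.toFinset, a i := by
              rw [List.prod_toFinset _ hun]
            simp only [Matrix.of_apply, Matrix.cons_val_zero, Matrix.cons_val_one,
              Matrix.cons_val', Matrix.cons_val_fin_one]
            rw [hd, Finset.prod_add, ha, Finset.mul_sum, Finset.mul_sum]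
            refine Finset.sum_congr rfl fun V hV => ?_
            rw [Finset.mem_powerset] at hV
            have hVv : ∀ i ∈ V, i ∈ v := fun i hi => by simpa using hV hi
            rw [if_pos ⟨trivial, fun i hi hiV => hdis i hi i (by simp [hVv i hiV]) rfl⟩, one_smul]
            have hs : ((Finset.range n).erase j) \ V = u.toFinset ∪ (v.toFinset \ V) := by
              ext i
              simp only [Finset.mem_sdiff, Finset.mem_erase, hmem, Finset.mem_union,
                List.mem_toFinset]
              constructor
              · tauto
              · rintro (h | h)
                · exact ⟨⟨fun e => hdis i h j (by simp) e, Or.inl h⟩,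
                    fun hiV => hdis i h i (by simp [hVv i hiV]) rfl⟩
                · exact ⟨⟨fun e => hjv.1 (e ▸ h.1), by tauto⟩, h.2⟩
            rw [hs, Finset.prod_union]
            · ring
            · rw [Finset.disjoint_left]
              intro i hi hi'
              simp at hi hi'
              exact hdis i hi i (by simp [hi'.1]) rfl
          · intro V hV hV'
            rw [if_neg, zero_smul]
            rintro ⟨-, h⟩
            apply hV'
            rw [Finset.mem_powerset] at hV ⊢
            intro i hi
            have := hV hi
            rw [Finset.mem_erase, hmem] at this
            rw [List.mem_toFinset]
            have := h i
            tauto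
        · intro j' _ hne
          refine Finset.sum_eq_zero fun V _ => ?_
          rw [if_neg (fun h => hne h.1.symm), zero_smul]
        · intro h; exact absurd ((hmem j).mpr (by simp)) h
      · simp [TT_apply, T0_apply, psi_two _ _ _ w u v x j j' hu hv hj hj']

theorem mono_mem (n : ℕ) (L : List ℕ) (w : ℕ → Bool) (hL : L.Perm (List.range n)) :
    mono F w L ∈ PnGr F n := by
  rw [PnGr_eq]; exact Submodule.subset_span ⟨L, w, hL, rfl⟩

/-- dual basis elements -/
theorem exists_dual (n : ℕ) (j : ℕ) (hj : j < n) (V : Finset ℕ) :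
    V ⊆ (Finset.range n).erase j → ∃ f ∈ PnGr F n, T0 F f = 0 ∧
      ∀ j' V', V' ⊆ (Finset.range n).erase j' →
        TT F j' V' f = if j' = j ∧ V' = V then 1 else 0 := by
  induction V using Finset.strongInduction with
  | H V ih =>
    intro hV
    let u := (((Finset.range n).erase j) \ V).toList
    let v := V.toList
    have hjV : j ∉ V := fun h => by simpa using hV h
    have hperm : (u ++ j :: v).Perm (List.range n) := by
      rw [List.perm_ext_iff_of_nodup _ List.nodup_range]
      · intro i
        simp only [u, v, List.mem_append, List.mem_cons, Finset.mem_toList, Finset.mem_sdiff,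
          Finset.mem_erase, Finset.mem_range, List.mem_range]
        constructor
        · rintro (h | h | h)
          · exact h.1.2
          · omega
          · simpa using (Finset.mem_erase.mp (hV h)).2
        · tauto
      · rw [List.nodup_append]
        refine ⟨Finset.nodup_toList _, List.nodup_cons.mpr ⟨by simpa [v] using hjV,
          Finset.nodup_toList _⟩, ?_⟩
        intro i hi k hk e
        subst e
        simp [u, v] at hi hk
        tauto
    let w : ℕ → Bool := fun i => decide (i = j)
    have hu : ∀ i ∈ u, w i = false := by intro i hi; simp [u] at hi; simp [w]; tauto
    have hv : ∀ i ∈ v, w i = false := by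
      intro i hi; simp [v] at hi; simp [w]; rintro rfl; exact hjV hi
    have hwj : w j = true := by simp [w]
    have hch : ∀ W : Finset ℕ, ∃ f ∈ PnGr F n, W ⊂ V → (T0 F f = 0 ∧
      ∀ j' V', V' ⊆ (Finset.range n).erase j' →
        TT F j' V' f = if j' = j ∧ V' = W then 1 else 0) := by
      intro W
      by_cases hW : W ⊂ V
      · obtain ⟨f, h1, h2⟩ := ih W hW (hW.1.trans hV)
        exact ⟨f, h1, fun _ => h2⟩
      · exact ⟨0, Submodule.zero_mem _, fun h => absurd h hW⟩
    choose g hg hg' using hch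
    refine ⟨mono F w (u ++ j :: v) - ∑ W ∈ V.ssubsets, g W, ?_, ?_, ?_⟩
    · exact Submodule.sub_mem _ (mono_mem n _ _ hperm) (Submodule.sum_mem _ fun W _ => hg W)
    · rw [map_sub, T0_one w u v j hu hv hwj, map_sum, Finset.sum_eq_zero, sub_zero]
      intro W hW
      exact (hg' W (Finset.mem_ssubsets.mp hW)).1
    · intro j' V' hV'
      rw [map_sub, TT_one w u v j hu hv hwj, map_sum]
      have : ∑ W ∈ V.ssubsets, TT F j' V' (g W) =
          ∑ W ∈ V.ssubsets, if j' = j ∧ V' = W then (1 : F) else 0 :=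
        Finset.sum_congr rfl fun W hW => (hg' W (Finset.mem_ssubsets.mp hW)).2 j' V' hV'
      rw [this]
      by_cases e : j' = j
      · subst e
        have hiff : (∀ i ∈ u, i ∉ V') ↔ V' ⊆ V := by
          constructor
          · intro h i hi
            by_contra hn
            refine h i ?_ hi
            simpa [u] using ⟨by simpa using hV' hi, hn⟩
          · intro h i hi hi'
            simp [u] at hi
            exact hi.2 (h hi')
        simp only [true_and, hiff, Finset.sum_ite_eq, Finset.mem_ssubsets]
        by_cases h1 : V' = V
        · subst h1; simp
        · by_cases h2 : V' ⊆ V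
          · simp [h1, h2, Finset.ssubset_iff_subset_ne]
          · simp [h1, h2, Finset.ssubset_iff_subset_ne]
      · simp [e, Ne.symm e]

theorem exists_T (n : ℕ) (c : F) (g : ℕ → Finset ℕ → F) :
    ∃ f ∈ PnGr F n, T0 F f = c ∧ ∀ j < n, ∀ V, V ⊆ (Finset.range n).erase j →
      TT F j V f = g j V := by
  have hch : ∀ (j : ℕ) (V : Finset ℕ), ∃ f ∈ PnGr F n, j < n → V ⊆ (Finset.range n).erase j →
      (T0 F f = 0 ∧ ∀ j' V', V' ⊆ (Finset.range n).erase j' →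
        TT F j' V' f = if j' = j ∧ V' = V then 1 else 0) := by
    intro j V
    by_cases h : j < n ∧ V ⊆ (Finset.range n).erase j
    · obtain ⟨f, h1, h2⟩ := exists_dual (F := F) n j h.1 V h.2
      exact ⟨f, h1, fun _ _ => h2⟩
    · exact ⟨0, Submodule.zero_mem _, fun h1 h2 => absurd ⟨h1, h2⟩ h⟩
  choose G hG hG' using hch
  refine ⟨c • mono F (fun _ => false) (List.range n) + ∑ j ∈ Finset.range n,
    ∑ V ∈ ((Finset.range n).erase j).powerset, g j V • G j V, ?_, ?_, ?_⟩
  · exact Submodule.add_mem _ (Submodule.smul_mem _ _ (mono_mem n _ _ (List.Perm.refl _)))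
      (Submodule.sum_mem _ fun j _ => Submodule.sum_mem _ fun V _ =>
        Submodule.smul_mem _ _ (hG j V))
  · simp only [map_add, map_sum, map_smul]
    rw [T0_even _ _ (by simp), Finset.sum_eq_zero]
    · simp
    · intro j hj
      refine Finset.sum_eq_zero fun V hV => ?_
      rw [(hG' j V (Finset.mem_range.mp hj) (Finset.mem_powerset.mp hV)).1, smul_zero]
  · intro j hj V hV
    simp only [map_add, map_sum, map_smul]
    rw [TT_even _ _ (by simp)]
    have : ∀ j' ∈ Finset.range n, ∀ V' ∈ ((Finset.range n).erase j').powerset,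
        g j' V' • TT F j V (G j' V') = if j = j' then (if V = V' then g j' V' else 0) else 0 := by
      intro j' hj' V' hV'
      rw [(hG' j' V' (Finset.mem_range.mp hj') (Finset.mem_powerset.mp hV')).2 j V hV]
      by_cases h1 : j = j' <;> by_cases h2 : V = V' <;> simp [h1, h2]
    rw [Finset.sum_congr rfl fun j' hj' => Finset.sum_congr rfl (this j' hj')]
    rw [Finset.sum_eq_single j]
    · rw [Finset.sum_eq_single V]
      · simp
      · intro V' _ h; simp [Ne.symm h]
      · intro h; exact absurd (Finset.mem_powerset.mpr hV) h
    · intro j' _ h; simp [Ne.symm h]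
    · intro h; exact absurd (Finset.mem_range.mpr hj) h

theorem constTerm_Pn (n : ℕ) (hn : 1 ≤ n) (f : FA F) (hf : f ∈ PnGr F n) :
    constTerm F f = 0 := by
  rw [PnGr_eq] at hf
  induction hf using Submodule.span_induction with
  | zero => simp
  | add x y hx hy h1 h2 => simp [h1, h2]
  | smul c x hx h1 => simp [h1]
  | mem x hx =>
    obtain ⟨L, w, hL, rfl⟩ := hx
    cases L with
    | nil => have := hL.length_eq; simp at this; omega
    | cons i L =>
      rw [mono_cons, map_mul]
      have : constTerm F (lett F w i) = 0 := by
        unfold lett; split_ifs <;> simp [constTerm, zv, yv]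
      rw [this, zero_mul]

end Part1

/-! ### Part 2: the algebra `N_k` -/
section Part2
open Polynomial
variable {F : Type} [Field F] {k : ℕ}

/-- the even part of `E` -/
noncomputable def DMat (F : Type) [Field F] (k : ℕ) : Matrix (Fin k) (Fin k) F :=
  Matrix.of fun a b => if 1 ≤ (a : ℕ) ∧ (a : ℕ) + 1 = (b : ℕ) then 1 else 0

theorem eMat_mul_D (i j : ℕ) (hj : 1 ≤ j) :
    eMat F k i j * DMat F k = eMat F k i (j + 1) := by
  ext a b
  rw [Matrix.mul_apply]
  simp only [eMat, DMat, Matrix.of_apply]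
  by_cases hb : (b : ℕ) = j + 1
  · have hjk : j < k := by have := b.2; omega
    rw [Finset.sum_eq_single ⟨j, hjk⟩]
    · simp [hb, hj]
    · intro c _ hc
      have : (c : ℕ) ≠ j := fun h => hc (Fin.ext h)
      simp [this]
    · simp
  · rw [Finset.sum_eq_zero]
    · simp [hb]
    · intro c _
      by_cases hc : (c : ℕ) = j
      · have : ¬ (j + 1 = (b : ℕ)) := fun h => hb h.symm
        simp [hc, this]
      · simp [hc]

theorem e01_pow (m : ℕ) : eMat F k 0 1 * DMat F k ^ m = eMat F k 0 (m + 1) := by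
  induction m with
  | zero => simp
  | succ m ih => rw [pow_succ, ← mul_assoc, ih, eMat_mul_D _ _ (by omega)]

theorem D_mul_e (j : ℕ) : DMat F k * eMat F k 0 j = 0 := by
  ext a b
  rw [Matrix.mul_apply]
  refine Finset.sum_eq_zero fun c _ => ?_
  simp only [eMat, DMat, Matrix.of_apply]
  by_cases hc : (c : ℕ) = 0
  · simp [hc]
  · simp [hc]

theorem e_mul_e (i j : ℕ) (hi : 1 ≤ i) : eMat F k 0 i * eMat F k 0 j = 0 := by
  ext a b
  rw [Matrix.mul_apply]
  refine Finset.sum_eq_zero fun c _ => ?_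
  simp only [eMat, Matrix.of_apply]
  by_cases hc : (c : ℕ) = 0
  · have : ¬ (0 = i) := by omega
    simp [hc, this]
  · simp [hc]

theorem D_pow (m : ℕ) (a b : Fin k) : (DMat F k ^ (m + 1)) a b =
    if 1 ≤ (a : ℕ) ∧ (a : ℕ) + (m + 1) = (b : ℕ) then 1 else 0 := by
  induction m generalizing a b with
  | zero => simp [DMat]
  | succ m ih =>
    rw [pow_succ, Matrix.mul_apply]
    simp only [ih]
    by_cases h : 1 ≤ (a : ℕ) ∧ (a : ℕ) + (m + 1 + 1) = (b : ℕ)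
    · have hlt : (a : ℕ) + (m + 1) < k := by have := b.2; omega
      rw [Finset.sum_eq_single ⟨(a : ℕ) + (m + 1), hlt⟩]
      · rw [if_pos ⟨h.1, rfl⟩, if_pos h, one_mul]
        simp only [DMat, Matrix.of_apply]
        rw [if_pos]; omega
      · intro c _ hc
        rw [if_neg, zero_mul]
        rintro ⟨-, h⟩
        exact hc (Fin.ext h.symm)
      · simp
    · rw [if_neg h]
      refine Finset.sum_eq_zero fun c _ => ?_
      by_cases hc : 1 ≤ (a : ℕ) ∧ (a : ℕ) + (m + 1) = (c : ℕ)
      · simp only [DMat, Matrix.of_apply]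
        rw [if_neg (c := 1 ≤ (c : ℕ) ∧ (c : ℕ) + 1 = (b : ℕ)), mul_zero]
        omega
      · rw [if_neg hc, zero_mul]

theorem D_pow_zero (m : ℕ) (hm : k ≤ m + 1) (hm1 : 1 ≤ m) : DMat F k ^ m = 0 := by
  obtain ⟨m, rfl⟩ : ∃ m', m = m' + 1 := ⟨m - 1, by omega⟩
  ext a b
  rw [D_pow, if_neg]
  · rfl
  · have := b.2; omega

theorem E_eq : EMat F k = DMat F k + eMat F k 0 1 := by
  ext a b
  simp only [EMat, DMat, eMat, Matrix.of_apply, Matrix.add_apply]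
  by_cases ha : (a : ℕ) = 0
  · simp [ha, eq_comm]
  · have : 1 ≤ (a : ℕ) := by omega
    simp [ha, this]

theorem E_pow (m : ℕ) :
    EMat F k ^ (m + 1) = DMat F k ^ (m + 1) + eMat F k 0 (m + 1) := by
  induction m with
  | zero => simp [E_eq]
  | succ m ih =>
    have h1 : DMat F k ^ (m + 1) * eMat F k 0 1 = 0 := by
      rw [pow_succ, mul_assoc, D_mul_e, mul_zero]
    rw [pow_succ, ih, E_eq, add_mul, mul_add, mul_add, e_mul_e _ _ (by omega),
      eMat_mul_D _ _ (by omega), h1, ← pow_succ]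
    simp

/-- normal form -/
noncomputable def nf (F : Type) [Field F] (k : ℕ) (p q : F[X]) : Matrix (Fin k) (Fin k) F :=
  aeval (DMat F k) p + eMat F k 0 1 * aeval (DMat F k) q

theorem aeval_mul_e (p : F[X]) :
    aeval (DMat F k) p * eMat F k 0 1 = p.eval 0 • eMat F k 0 1 := by
  induction p using Polynomial.induction_on' with
  | add p q hp hq => rw [map_add, add_mul, hp, hq, eval_add, add_smul]
  | monomial m c =>
    rw [aeval_monomial, eval_monomial]
    cases m with
    | zero => simp [Algebra.algebraMap_eq_smul_one]
    | succ m =>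
      rw [pow_succ, mul_assoc, mul_assoc, D_mul_e]; simp

theorem nf_mul (p q p' q' : F[X]) :
    nf F k p q * nf F k p' q' = nf F k (p * p') (C (p.eval 0) * q' + q * p') := by
  unfold nf
  have h2 : eMat F k 0 1 * aeval (DMat F k) q * (eMat F k 0 1 * aeval (DMat F k) q') = 0 := by
    rw [mul_assoc, ← mul_assoc _ (eMat F k 0 1), aeval_mul_e, smul_mul_assoc, mul_smul_comm,
      ← mul_assoc, e_mul_e _ _ le_rfl]
    simp
  rw [add_mul, mul_add, mul_add, h2, ← mul_assoc _ (eMat F k 0 1), aeval_mul_e]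
  simp only [map_mul, map_add, mul_add, aeval_C, add_zero, Algebra.algebraMap_eq_smul_one,
    smul_mul_assoc, one_mul, mul_smul_comm, mul_assoc]
  abel

theorem nf_add (p q p' q' : F[X]) :
    nf F k p q + nf F k p' q' = nf F k (p + p') (q + q') := by
  unfold nf; rw [map_add, map_add, mul_add]; abel

theorem nf_smul (c : F) (p q : F[X]) : c • nf F k p q = nf F k (c • p) (c • q) := by
  unfold nf; rw [map_smul, map_smul, mul_smul_comm, smul_add]

theorem aeval_even (p : F[X]) : aeval (DMat F k) p ∈ matEvenPart F k := by
  induction p using Polynomial.induction_on' with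
  | add p q hp hq => rw [map_add]; exact Submodule.add_mem _ hp hq
  | monomial m c =>
    rw [aeval_monomial, ← Algebra.smul_def]
    refine Submodule.smul_mem _ _ ?_
    intro i j hij
    cases m with
    | zero =>
      rw [pow_zero, Matrix.one_apply_ne]
      rintro rfl; tauto
    | succ m => rw [D_pow, if_neg]; omega

theorem eMat_odd (m : ℕ) : eMat F k 0 (m + 1) ∈ matOddPart F k := by
  intro i j hij
  simp only [eMat, Matrix.of_apply]
  rw [if_neg]; omega

theorem eaeval_odd (q : F[X]) : eMat F k 0 1 * aeval (DMat F k) q ∈ matOddPart F k := by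
  induction q using Polynomial.induction_on' with
  | add p q hp hq => rw [map_add, mul_add]; exact Submodule.add_mem _ hp hq
  | monomial m c =>
    rw [aeval_monomial, ← Algebra.smul_def, mul_smul_comm, e01_pow]
    exact Submodule.smul_mem _ _ (eMat_odd m)

theorem even_odd_zero {x : Matrix (Fin k) (Fin k) F} (h0 : x ∈ matEvenPart F k)
    (h1 : x ∈ matOddPart F k) : x = 0 := by
  ext i j
  by_cases h : ((i : ℕ) = 0) ↔ ((j : ℕ) = 0)
  · exact h1 i j h
  · exact h0 i j (by tauto)

theorem eMat_mem (m : ℕ) : eMat F k 0 (m + 1) ∈ NkSub F k := by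
  by_cases h : m + 1 ≤ k - 1
  · exact Submodule.subset_span (Or.inr ⟨m + 1, by omega, h, rfl⟩)
  · have : eMat F k 0 (m + 1) = 0 := by
      ext a b
      simp only [eMat, Matrix.of_apply]
      rw [if_neg]
      · rfl
      · have := b.2; omega
    rw [this]; exact Submodule.zero_mem _

theorem aeval_mem (hk : 2 ≤ k) (p : F[X]) : aeval (DMat F k) p ∈ NkSub F k := by
  induction p using Polynomial.induction_on' with
  | add p q hp hq => rw [map_add]; exact Submodule.add_mem _ hp hq
  | monomial m c =>
    rw [aeval_monomial, ← Algebra.smul_def]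
    refine Submodule.smul_mem _ _ ?_
    cases m with
    | zero => rw [pow_zero]; exact Submodule.subset_span (Or.inl (Or.inl rfl))
    | succ m =>
      by_cases h : m + 1 ≤ k - 2
      · have : DMat F k ^ (m + 1) = EMat F k ^ (m + 1) - eMat F k 0 (m + 1) := by
          rw [E_pow]; simp
        rw [this]
        exact Submodule.sub_mem _
          (Submodule.subset_span (Or.inl (Or.inr ⟨m + 1, by omega, h, rfl⟩))) (eMat_mem m)
      · rw [D_pow_zero _ (by omega) (by omega)]; exact Submodule.zero_mem _

theorem eaeval_mem (q : F[X]) : eMat F k 0 1 * aeval (DMat F k) q ∈ NkSub F k := by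
  induction q using Polynomial.induction_on' with
  | add p q hp hq => rw [map_add, mul_add]; exact Submodule.add_mem _ hp hq
  | monomial m c =>
    rw [aeval_monomial, ← Algebra.smul_def, mul_smul_comm, e01_pow]
    exact Submodule.smul_mem _ _ (eMat_mem m)

theorem exists_nf {x : Matrix (Fin k) (Fin k) F} (hx : x ∈ NkSub F k) :
    ∃ p q, x = nf F k p q := by
  induction hx using Submodule.span_induction with
  | zero => exact ⟨0, 0, by simp [nf]⟩
  | add x y _ _ h1 h2 =>
    obtain ⟨p, q, rfl⟩ := h1
    obtain ⟨p', q', rfl⟩ := h2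
    exact ⟨_, _, nf_add _ _ _ _⟩
  | smul c x _ h1 =>
    obtain ⟨p, q, rfl⟩ := h1
    exact ⟨_, _, nf_smul _ _ _⟩
  | mem x hx =>
    rcases hx with (rfl | ⟨m, h1, -, rfl⟩) | ⟨m, h1, -, rfl⟩
    · exact ⟨1, 0, by simp [nf]⟩
    · obtain ⟨m, rfl⟩ : ∃ m', m = m' + 1 := ⟨m - 1, by omega⟩
      exact ⟨X ^ (m + 1), X ^ m, by simp [nf, e01_pow, E_pow]⟩
    · obtain ⟨m, rfl⟩ : ∃ m', m = m' + 1 := ⟨m - 1, by omega⟩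
      exact ⟨0, X ^ m, by simp [nf, e01_pow]⟩

theorem even_iff (hk : 2 ≤ k) (x : Matrix (Fin k) (Fin k) F) :
    x ∈ NkSub F k ⊓ matEvenPart F k ↔ ∃ p, x = nf F k p 0 := by
  constructor
  · rintro ⟨h1, h2⟩
    obtain ⟨p, q, rfl⟩ := exists_nf h1
    have : eMat F k 0 1 * aeval (DMat F k) q = 0 := by
      refine even_odd_zero ?_ (eaeval_odd q)
      have := Submodule.sub_mem _ h2 (aeval_even (k := k) p)
      simpa [nf] using this
    exact ⟨p, by simp [nf, this]⟩
  · rintro ⟨p, rfl⟩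
    have : nf F k p 0 = aeval (DMat F k) p := by simp [nf]
    rw [this]
    exact ⟨aeval_mem hk p, aeval_even p⟩

theorem odd_iff (hk : 2 ≤ k) (x : Matrix (Fin k) (Fin k) F) :
    x ∈ NkSub F k ⊓ matOddPart F k ↔ ∃ q, x = nf F k 0 q := by
  constructor
  · rintro ⟨h1, h2⟩
    obtain ⟨p, q, rfl⟩ := exists_nf h1
    have : aeval (DMat F k) p = 0 := by
      refine even_odd_zero (aeval_even p) ?_
      have := Submodule.sub_mem _ h2 (eaeval_odd (k := k) q)
      simpa [nf] using this
    exact ⟨q, by simp [nf, this]⟩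
  · rintro ⟨p, rfl⟩
    have : nf F k 0 p = eMat F k 0 1 * aeval (DMat F k) p := by simp [nf]
    rw [this]
    exact ⟨eaeval_mem p, eaeval_odd p⟩

theorem sup_iff (hk : 2 ≤ k) (x : Matrix (Fin k) (Fin k) F) :
    x ∈ (NkSub F k ⊓ matEvenPart F k) ⊔ (NkSub F k ⊓ matOddPart F k) ↔
      ∃ p q, x = nf F k p q := by
  rw [Submodule.mem_sup]
  constructor
  · rintro ⟨y, hy, z, hz, rfl⟩
    obtain ⟨p, rfl⟩ := (even_iff hk y).mp hy
    obtain ⟨q, rfl⟩ := (odd_iff hk z).mp hz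
    exact ⟨_, _, nf_add _ _ _ _⟩
  · rintro ⟨p, q, rfl⟩
    exact ⟨_, (even_iff hk _).mpr ⟨p, rfl⟩, _, (odd_iff hk _).mpr ⟨q, rfl⟩, by simp [nf_add]⟩

/-- evaluation through the generic algebra -/
theorem eval_eq (φ : FA F →ₐ[F] Matrix (Fin k) (Fin k) F) (p q : ℕ → F[X])
    (hy : ∀ i, φ (yv F i) = nf F k (p i) 0) (hz : ∀ i, φ (zv F i) = nf F k 0 (q i)) (f : FA F) :
    φ f = nf F k (PsiM F (fun i => C ((p i).eval 0)) p q f 1 1)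
      (PsiM F (fun i => C ((p i).eval 0)) p q f 0 1) := by
  set Ψ := PsiM F (fun i => C ((p i).eval 0)) p q with hΨ
  suffices h : Ψ f 0 0 = C ((Ψ f 1 1).eval 0) ∧ Ψ f 1 0 = 0 ∧
      φ f = nf F k (Ψ f 1 1) (Ψ f 0 1) from h.2.2
  induction f using FreeAlgebra.induction with
  | grade0 r =>
    simp [Algebra.algebraMap_eq_smul_one, nf, smul_eq_C_mul]
  | grade1 x =>
    rcases x with i | j
    · have h := hy i
      have h2 := PsiM_y (F := F) (fun i => C ((p i).eval 0)) p q i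
      rw [← hΨ] at h2
      unfold yv at h h2
      rw [h, h2]; simp
    · have h := hz j
      have h2 := PsiM_z (F := F) (fun i => C ((p i).eval 0)) p q j
      rw [← hΨ] at h2
      unfold zv at h h2
      rw [h, h2]; simp
  | mul a b ha hb =>
    obtain ⟨a1, a2, a3⟩ := ha
    obtain ⟨b1, b2, b3⟩ := hb
    simp only [map_mul, Matrix.mul_apply, Fin.sum_univ_two, a1, a2, b1, b2, a3, b3, nf_mul]
    simp
  | add a b ha hb =>
    obtain ⟨a1, a2, a3⟩ := ha
    obtain ⟨b1, b2, b3⟩ := hb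
    simp only [map_add, Matrix.add_apply, a1, a2, b1, b2, a3, b3, nf_add]
    simp

theorem e_ne (j : ℕ) (hj : j < k) : eMat F k 0 j ≠ 0 := by
  intro h
  have := congrFun (congrFun h ⟨0, by omega⟩) ⟨j, hj⟩
  simp [eMat] at this

theorem nf_q_zero (hk : 2 ≤ k) (q : F[X]) (h : X ^ (k - 1) ∣ q) : nf F k 0 q = 0 := by
  obtain ⟨r, rfl⟩ := h
  simp [nf, D_pow_zero (F := F) (k := k) (k - 1) (by omega) (by omega)]

end Part2

/-! ### Part 3: characterization of identities and central polynomials -/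
section Part3
open Polynomial
variable {F : Type} [Field F] {k : ℕ}

noncomputable def subst (F : Type) [Field F] (k : ℕ) (p q : ℕ → F[X]) :
    FA F →ₐ[F] Matrix (Fin k) (Fin k) F :=
  FreeAlgebra.lift F (Sum.elim (fun i => nf F k (p i) 0) (fun j => nf F k 0 (q j)))

theorem subst_y (p q : ℕ → F[X]) (i : ℕ) : subst F k p q (yv F i) = nf F k (p i) 0 := by
  simp [subst, yv]

theorem subst_z (p q : ℕ → F[X]) (i : ℕ) : subst F k p q (zv F i) = nf F k 0 (q i) := by
  simp [subst, zv]

theorem subst_gr (hk : 2 ≤ k) (p q : ℕ → F[X]) : IsGSubst F (Matrix (Fin k) (Fin k) F)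
    (NkSub F k ⊓ matEvenPart F k) (NkSub F k ⊓ matOddPart F k) (subst F k p q) :=
  ⟨fun i => (even_iff hk _).mpr ⟨p i, subst_y p q i⟩,
    fun i => (odd_iff hk _).mpr ⟨q i, subst_z p q i⟩⟩

theorem test_T0 (n : ℕ) (hn : 1 ≤ n) (f : FA F) (hf : f ∈ PnGr F n) :
    subst F k (fun i => if i = 0 then X else 1) (fun _ => 0) f = nf F k (T0 F f • X) 0 := by
  rw [eval_eq _ _ _ (subst_y _ _) (subst_z _ _) f]
  obtain ⟨h1, h2⟩ := main_formula n (fun i => C (eval 0 (if i = 0 then (X : F[X]) else 1)))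
    (fun i => if i = 0 then X else 1) (fun _ => 0) f hf
  rw [h1, h2]
  congr 1
  · rw [Finset.prod_ite_eq', if_pos (Finset.mem_range.mpr (by omega))]
  · simp

theorem test_TT (n : ℕ) (j : ℕ) (hj : j < n) (V : Finset ℕ) (hV : V ⊆ (Finset.range n).erase j)
    (f : FA F) (hf : f ∈ PnGr F n) : ∃ P,
    subst F k (fun i => if i ∈ V then X else 1) (fun i => if i = j then 1 else 0) f =
      nf F k P (TT F j V f • X ^ V.card) := by
  rw [eval_eq _ _ _ (subst_y _ _) (subst_z _ _) f]
  obtain ⟨h1, h2⟩ := main_formula n (fun i => C (eval 0 (if i ∈ V then (X : F[X]) else 1)))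
    (fun i => if i ∈ V then X else 1) (fun i => if i = j then 1 else 0) f hf
  rw [h2]
  refine ⟨_, congrArg _ ?_⟩
  rw [Finset.sum_eq_single j]
  · rw [Finset.sum_eq_single V]
    · congr 1
      rw [if_pos rfl, one_mul]
      have e1 : ∏ i ∈ V, ((if i ∈ V then X else 1) -
          C (eval 0 (if i ∈ V then (X : F[X]) else 1))) = X ^ V.card := by
        rw [← Finset.prod_const]
        refine Finset.prod_congr rfl fun i hi => ?_
        simp [hi]
      have e2 : ∏ i ∈ (Finset.range n).erase j \ V,
          C (eval 0 (if i ∈ V then (X : F[X]) else 1)) = 1 := by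
        refine Finset.prod_eq_one fun i hi => ?_
        simp [(Finset.mem_sdiff.mp hi).2]
      rw [e1, e2, mul_one]
    · intro V' hV' hne
      by_cases hsub : V' ⊆ V
      · have : ∃ i ∈ V, i ∉ V' := by
          by_contra hcon
          push Not at hcon
          exact hne (Finset.Subset.antisymm hsub hcon)
        obtain ⟨i, hi, hi'⟩ := this
        rw [Finset.prod_eq_zero (i := i) (s := (Finset.range n).erase j \ V')
          (Finset.mem_sdiff.mpr ⟨hV hi, hi'⟩) (by simp [hi])]
        simp
      · obtain ⟨i, hi, hi'⟩ := Finset.not_subset.mp hsub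
        rw [Finset.prod_eq_zero (i := i) (s := V') hi (by simp [hi'])]
        simp
    · intro h; exact absurd (Finset.mem_powerset.mpr hV) h
  · intro j' _ hne
    simp [hne]
  · intro h; exact absurd (Finset.mem_range.mpr hj) h

theorem nf_zero_X (t : F) (m : ℕ) (hm : m + 1 < k) (h : nf F k 0 (t • X ^ m) = 0) : t = 0 := by
  simp only [nf, map_zero, zero_add, map_smul, map_pow, aeval_X, mul_smul_comm, e01_pow] at h
  rcases smul_eq_zero.mp h with h | h
  · exact h
  · exact absurd h (e_ne _ hm)

theorem dvd_of_T (n m : ℕ) (f : FA F) (hf : f ∈ PnGr F n) (p q : ℕ → F[X])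
    (h : ∀ j < n, ∀ V, V ⊆ (Finset.range n).erase j → V.card < m → TT F j V f = 0) :
    X ^ m ∣ PsiM F (fun i => C ((p i).eval 0)) p q f 0 1 := by
  rw [(main_formula n _ p q f hf).2]
  refine Finset.dvd_sum fun j hj => Finset.dvd_sum fun V hV => ?_
  by_cases hc : V.card < m
  · rw [h j (Finset.mem_range.mp hj) V (Finset.mem_powerset.mp hV) hc, zero_smul]
    exact dvd_zero _
  · refine dvd_smul_of_dvd _ (Dvd.dvd.mul_left (Dvd.dvd.mul_right ?_ _) _)
    refine (pow_dvd_pow X (not_lt.mp hc)).trans ?_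
    rw [← Finset.prod_const]
    refine Finset.prod_dvd_prod_of_dvd _ _ fun i _ => ?_
    rw [X_dvd_iff, coeff_sub, coeff_C_zero, coeff_zero_eq_eval_zero, sub_self]

theorem gr_exists (hk : 2 ≤ k) (φ : FA F →ₐ[F] Matrix (Fin k) (Fin k) F)
    (hφ : IsGSubst F (Matrix (Fin k) (Fin k) F)
      (NkSub F k ⊓ matEvenPart F k) (NkSub F k ⊓ matOddPart F k) φ) :
    ∃ p q : ℕ → F[X], (∀ i, φ (yv F i) = nf F k (p i) 0) ∧
      (∀ i, φ (zv F i) = nf F k 0 (q i)) := by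
  choose p hp using fun i => (even_iff hk _).mp (hφ.1 i)
  choose q hq using fun i => (odd_iff hk _).mp (hφ.2 i)
  exact ⟨p, q, hp, hq⟩

theorem C_iff (n : ℕ) (hk : 3 ≤ k) (hn : 1 ≤ n) (f : FA F) (hf : f ∈ PnGr F n) :
    f ∈ CGr F (Matrix (Fin k) (Fin k) F)
          (NkSub F k ⊓ matEvenPart F k) (NkSub F k ⊓ matOddPart F k) ↔
    T0 F f = 0 ∧ ∀ j < n, ∀ V, V ⊆ (Finset.range n).erase j → V.card < k - 2 →
      TT F j V f = 0 := by
  have hk2 : 2 ≤ k := by omega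
  constructor
  · rintro ⟨-, h⟩
    constructor
    · have h1 := (h _ (subst_gr hk2 (fun i => if i = 0 then X else 1) (fun _ => 0))).2
        (nf F k 0 1) ((sup_iff hk2 _).mpr ⟨0, 1, rfl⟩)
      rw [test_T0 n hn f hf, nf_mul, nf_mul] at h1
      refine nf_zero_X (k := k) (T0 F f) 1 (by omega) ?_
      simp at h1
      rw [pow_one, ← h1]
      simp [nf]
    · intro j hj V hV hc
      have h1 := (h _ (subst_gr hk2 (fun i => if i ∈ V then X else 1)
        (fun i => if i = j then 1 else 0))).2 (nf F k X 0) ((sup_iff hk2 _).mpr ⟨X, 0, rfl⟩)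
      obtain ⟨P, hP⟩ := test_TT (k := k) n j hj V hV f hf
      rw [hP, nf_mul, nf_mul] at h1
      refine nf_zero_X (k := k) (TT F j V f) (V.card + 1) (by omega) ?_
      simp only [mul_zero, zero_add, zero_mul, add_zero, eval_X, C_0, mul_comm P,
        smul_mul_assoc, ← pow_succ] at h1
      have : nf F k (X * P) (TT F j V f • X ^ (V.card + 1)) =
        nf F k (X * P) 0 + nf F k 0 (TT F j V f • X ^ (V.card + 1)) := by simp [nf_add]
      rw [this] at h1
      simpa using h1
  · rintro ⟨h0, h⟩
    refine ⟨constTerm_Pn n hn f hf, fun φ hφ => ?_⟩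
    obtain ⟨p, q, hp, hq⟩ := gr_exists hk2 φ hφ
    have he := eval_eq φ p q hp hq f
    refine ⟨(sup_iff hk2 _).mpr ⟨_, _, he⟩, fun y hy => ?_⟩
    obtain ⟨P, Q, rfl⟩ := (sup_iff hk2 _).mp hy
    rw [(main_formula n _ p q f hf).1, h0, zero_smul] at he
    obtain ⟨r, hr⟩ := dvd_of_T n (k - 2) f hf p q h
    rw [hr] at he
    rw [he, nf_mul, nf_mul]
    simp only [zero_mul, mul_zero, eval_zero, C_0, zero_add, add_zero]
    have e : nf F k 0 (X ^ (k - 2) * r * P) = nf F k 0 (C (eval 0 P) * (X ^ (k - 2) * r)) +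
        nf F k 0 (X ^ (k - 2) * r * (P - C (eval 0 P))) := by
      rw [nf_add]; congr 1
      · simp
      · ring
    rw [e, nf_q_zero hk2 (X ^ (k - 2) * r * (P - C (eval 0 P))), add_zero]
    have hX : X ∣ P - C (eval 0 P) := by
      rw [X_dvd_iff, coeff_sub, coeff_C_zero, coeff_zero_eq_eval_zero, sub_self]
    have hkk : k - 1 = (k - 2) + 1 := by omega
    rw [hkk, pow_succ]
    exact mul_dvd_mul (dvd_mul_right _ _) hX

theorem Id_iff (n : ℕ) (hk : 3 ≤ k) (hn : 1 ≤ n) (f : FA F) (hf : f ∈ PnGr F n) :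
    f ∈ IdGr F (Matrix (Fin k) (Fin k) F)
          (NkSub F k ⊓ matEvenPart F k) (NkSub F k ⊓ matOddPart F k) ↔
    T0 F f = 0 ∧ ∀ j < n, ∀ V, V ⊆ (Finset.range n).erase j → V.card < k - 1 →
      TT F j V f = 0 := by
  have hk2 : 2 ≤ k := by omega
  constructor
  · intro h
    have hC : f ∈ CGr F (Matrix (Fin k) (Fin k) F)
          (NkSub F k ⊓ matEvenPart F k) (NkSub F k ⊓ matOddPart F k) :=
      ⟨constTerm_Pn n hn f hf, fun φ hφ => by
        rw [h φ hφ]; exact Submodule.zero_mem _⟩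
    refine ⟨((C_iff n hk hn f hf).mp hC).1, ?_⟩
    intro j hj V hV hc
    have h1 := h _ (subst_gr hk2 (fun i => if i ∈ V then X else 1)
        (fun i => if i = j then 1 else 0))
    obtain ⟨P, hP⟩ := test_TT (k := k) n j hj V hV f hf
    rw [hP] at h1
    refine nf_zero_X (k := k) (TT F j V f) V.card (by omega) ?_
    unfold nf at h1 ⊢
    rw [map_zero, zero_add]
    refine even_odd_zero ?_ (eaeval_odd _)
    rw [eq_neg_of_add_eq_zero_right h1]
    exact Submodule.neg_mem _ (aeval_even _)
  · rintro ⟨h0, h⟩ φ hφ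
    obtain ⟨p, q, hp, hq⟩ := gr_exists hk2 φ hφ
    rw [eval_eq φ p q hp hq f, (main_formula n _ p q f hf).1, h0, zero_smul]
    exact nf_q_zero hk2 _ (dvd_of_T n (k - 1) f hf p q h)

end Part3

/-! ### Part 4: dimensions -/
section Part4
variable {F : Type} [Field F]

/-- index set -/
def idx (n : ℕ) (A : Finset ℕ) : Finset (Σ _ : ℕ, Finset ℕ) :=
  (Finset.range n).sigma fun j => ((Finset.range n).erase j).powerset.filter fun V => V.card ∈ A

theorem idx_card (n : ℕ) (A : Finset ℕ) :
    (idx n A).card = ∑ i ∈ A, (i + 1) * Nat.choose n (i + 1) := by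
  unfold idx
  rw [Finset.card_sigma]
  have : ∀ j ∈ Finset.range n, (((Finset.range n).erase j).powerset.filter
      fun V => V.card ∈ A).card = ∑ i ∈ A, Nat.choose (n - 1) i := by
    intro j hj
    rw [Finset.card_eq_sum_card_fiberwise (f := Finset.card) (t := A)]
    · refine Finset.sum_congr rfl fun i hi => ?_
      have : (((Finset.range n).erase j).powerset.filter fun V => V.card ∈ A).filter
          (fun V => V.card = i) = ((Finset.range n).erase j).powersetCard i := by
        ext V
        simp only [Finset.mem_filter, Finset.mem_powerset, Finset.mem_powersetCard]
        constructor
        · rintro ⟨⟨h1, h2⟩, h3⟩; exact ⟨h1, h3⟩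
        · rintro ⟨h1, h3⟩; exact ⟨⟨h1, h3 ▸ hi⟩, h3⟩
      rw [this, Finset.card_powersetCard, Finset.card_erase_of_mem hj, Finset.card_range]
    · intro V hV
      exact (Finset.mem_filter.mp hV).2
  rw [Finset.sum_congr rfl this, Finset.sum_const, Finset.card_range, smul_eq_mul, Finset.mul_sum]
  refine Finset.sum_congr rfl fun i _ => ?_
  cases n with
  | zero => simp
  | succ n =>
    have := Nat.add_one_mul_choose_eq n i
    simp only [Nat.add_sub_cancel]
    rw [this, mul_comm]

noncomputable def TA (F : Type) [Field F] (n : ℕ) (A : Finset ℕ) : FA F →ₗ[F] (idx n A → F) :=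
  LinearMap.pi fun x => TT F x.1.1 x.1.2

theorem mem_idx (n : ℕ) (A : Finset ℕ) (j : ℕ) (V : Finset ℕ) :
    (⟨j, V⟩ : Σ _ : ℕ, Finset ℕ) ∈ idx n A ↔
      j < n ∧ V ⊆ (Finset.range n).erase j ∧ V.card ∈ A := by
  simp [idx]

theorem TA_zero_iff (n : ℕ) (A : Finset ℕ) (f : FA F) : TA F n A f = 0 ↔
    ∀ j < n, ∀ V, V ⊆ (Finset.range n).erase j → V.card ∈ A → TT F j V f = 0 := by
  constructor
  · intro h j hj V hV hc
    exact congrFun h ⟨⟨j, V⟩, (mem_idx _ _ _ _).mpr ⟨hj, hV, hc⟩⟩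
  · intro h
    ext ⟨⟨j, V⟩, hx⟩
    obtain ⟨h1, h2, h3⟩ := (mem_idx _ _ _ _).mp hx
    exact h j h1 V h2 h3

theorem exists_TA (n : ℕ) (A : Finset ℕ) (c : F) (g : idx n A → F) :
    ∃ f ∈ PnGr F n, T0 F f = c ∧ TA F n A f = g ∧
      ∀ j < n, ∀ V, V ⊆ (Finset.range n).erase j → V.card ∉ A → TT F j V f = 0 := by
  obtain ⟨f, h1, h2, h3⟩ := exists_T (F := F) n c
    (fun j V => if h : (⟨j, V⟩ : Σ _ : ℕ, Finset ℕ) ∈ idx n A then g ⟨_, h⟩ else 0)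
  refine ⟨f, h1, h2, ?_, ?_⟩
  · ext ⟨⟨j, V⟩, hx⟩
    obtain ⟨h4, h5, h6⟩ := (mem_idx _ _ _ _).mp hx
    have := h3 j h4 V h5
    rw [dif_pos hx] at this
    exact this
  · intro j hj V hV hc
    rw [h3 j hj V hV, dif_neg]
    intro h
    exact hc ((mem_idx _ _ _ _).mp h).2.2

theorem finrank_quot {M N : Type} [AddCommGroup M] [Module F M] [AddCommGroup N] [Module F N]
    (S : Submodule F M) (g : M →ₗ[F] N) (hg : Function.Surjective g)
    (hS : ∀ x, x ∈ S ↔ g x = 0) : Module.finrank F (M ⧸ S) = Module.finrank F N := by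
  have : S = LinearMap.ker g := by ext x; rw [hS, LinearMap.mem_ker]
  subst this
  exact (g.quotKerEquivOfSurjective hg).finrank_eq

end Part4
/-- for `k ≥ 3`, `n ≥ 1`:
`c_n^{gr,z}(N_k^{gr}) = 1 + Σ_{i=1}^{k-2} i·C(n,i)` and
`δ_n^{gr}(N_k^{gr}) = (k-1)·C(n,k-1)`. -/
theorem stmt11 (F : Type) [Field F] [CharZero F] (k n : ℕ) (hk : 3 ≤ k) (hn : 1 ≤ n) :
    scodim F (PnGr F n)
        (CGr F (Matrix (Fin k) (Fin k) F)
          (NkSub F k ⊓ matEvenPart F k) (NkSub F k ⊓ matOddPart F k)) =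
        1 + ∑ i ∈ Finset.Icc 1 (k - 2), i * Nat.choose n i ∧
    deltaDim F (PnGr F n)
        (CGr F (Matrix (Fin k) (Fin k) F)
          (NkSub F k ⊓ matEvenPart F k) (NkSub F k ⊓ matOddPart F k))
        (IdGr F (Matrix (Fin k) (Fin k) F)
          (NkSub F k ⊓ matEvenPart F k) (NkSub F k ⊓ matOddPart F k)) =
      (k - 1) * Nat.choose n (k - 1) := by
  constructor
  · unfold scodim
    rw [finrank_quot _ (((T0 F).prod (TA F n (Finset.range (k - 2)))).comp (PnGr F n).subtype)]
    · rw [Module.finrank_prod, Module.finrank_self, Module.finrank_fintype_fun_eq_card,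
        Fintype.card_coe, idx_card, Finset.range_eq_Ico,
        Finset.sum_Ico_add' (fun i => i * Nat.choose n i) 0 (k - 2) 1]
      congr 1
    · rintro ⟨c, g⟩
      obtain ⟨f, h1, h2, h3, -⟩ := exists_TA (F := F) n (Finset.range (k - 2)) c g
      exact ⟨⟨f, h1⟩, Prod.ext h2 h3⟩
    · rintro ⟨f, hf⟩
      rw [Submodule.mem_comap, Submodule.subtype_apply, C_iff n hk hn f hf, LinearMap.comp_apply,
        Submodule.subtype_apply]
      have e : ((T0 F).prod (TA F n (Finset.range (k - 2)))) f =
        (T0 F f, TA F n (Finset.range (k - 2)) f) := rfl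
      rw [e, Prod.mk_eq_zero, TA_zero_iff]
      simp only [Finset.mem_range]
  · unfold deltaDim
    rw [finrank_quot _ ((TA F n {k - 2}).comp (PnGr F n ⊓ CGr F (Matrix (Fin k) (Fin k) F)
          (NkSub F k ⊓ matEvenPart F k) (NkSub F k ⊓ matOddPart F k)).subtype)]
    · rw [Module.finrank_fintype_fun_eq_card, Fintype.card_coe, idx_card, Finset.sum_singleton]
      have : k - 2 + 1 = k - 1 := by omega
      rw [this]
    · intro g
      obtain ⟨f, h1, h2, h3, h4⟩ := exists_TA (F := F) n {k - 2} 0 g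
      refine ⟨⟨f, h1, (C_iff n hk hn f h1).mpr ⟨h2, fun j hj V hV hc => h4 j hj V hV ?_⟩⟩, h3⟩
      simp only [Finset.mem_singleton]; omega
    · rintro ⟨f, hf, hC⟩
      have hC' := (C_iff n hk hn f hf).mp hC
      rw [Submodule.mem_comap, Submodule.subtype_apply, Submodule.mem_inf, Id_iff n hk hn f hf,
        LinearMap.comp_apply, Submodule.subtype_apply, TA_zero_iff]
      constructor
      · rintro ⟨-, -, h⟩ j hj V hV hc
        refine h j hj V hV ?_
        simp only [Finset.mem_singleton] at hc; omega
      · intro h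
        refine ⟨hf, hC'.1, fun j hj V hV hc => ?_⟩
        by_cases hlt : V.card < k - 2
        · exact hC'.2 j hj V hV hlt
        · refine h j hj V hV ?_
          simp only [Finset.mem_singleton]; omega
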